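/- Let K be a commutative semiring, m ≥ 2, w ≥ 2, 1 ≤ r ≤ w−1, and 1 ≤ k, ℓ ≤ m. Set L = (w−1)m + ((ℓ−k) mod m) + 1 and L₅ = (r−1)m + (m−k+1). Take weights s₁, …, s_m and a chain c₁, …, c_L where c_j carries the weight s_{((k+j−2) mod m)+1}. Let A, B, D be finite posets with distinguished elements a ∈ A, b ∈ B, d ∈ D. Define configurations by generating relations (always including the orders of the tail posets involved): P₁ on A ∪ {c₁, …, c_L} ∪ B with c₁ ≺ c₂ ≺ ⋯ ≺ c_L, c₁ ≺ a, and b ≺ c_L; P₃ on {c_{L₅+1}, …, c_L} ∪ D ∪ B with c_{L₅+1} ≺ ⋯ ≺ c_L, c_{L₅+1} ≺ d, and b ≺ c_L; P₅ on A ∪ {c₁, …, c_{L₅}} ∪ D with c₁ ≺ ⋯ ≺ c_{L₅}, c₁ ≺ a, and d ≺ c_{L₅}. Let Y′ = ∏_{j=1}^{L₅} s_{((k+j−2) mod m)+1}. Then Z(P₁) · Z(D) = Y′ · Z(P₃) · Z(A) + Z(P₅) · Z(B), where Z(A), Z(B), Z(D) are the sums over lower sets of the respective posets of the products of the weights of their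 elements. -/

import Mathlib

/-!
The combinatorial content of the first (plain) formula of Proposition 5.2 of the paper
(Type 1 grafting), in the down-set formalism: an arc `γ₁` winds `w − 1` times around a
puncture `p` with spokes of weights `s₁, …, s_m`, crossing the ascending chain of
spokes recorded by `c₁, …, c_L` (with cyclic weights starting at `s_k` and ending at
`s_ℓ`) between its tails `A` and `B`, while `γ₂` is plain at `p` with poset `D`;
resolving the `r`-th intersection gives
`Z(P₁) · Z(D) = Y′ · Z(P₃) · Z(A) + Z(P₅) · Z(B)`
with `Y′ = ∏_{j=1}^{L₅} s_{((k+j−2) mod m)+1}`.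
(The winding number `w` of the statement is called `W` here, to avoid a clash with the
weight functions.)
-/

attribute [local instance] Classical.propDecidable

noncomputable section

/-- The ideal sum of a configuration: the sum, over all down-sets `S` of the ground set
(`S ⊆ ground`, closed under the generating relations: `rel x y` with `x ∈ ground` and
`y ∈ S` implies `x ∈ S`), of the product of the weights of the elements of `S`. -/
def idealSum {α K : Type*} [CommSemiring K]
    (ground : Finset α) (rel : α → α → Prop) (w : α → K) : K :=
  ∑ S ∈ ground.powerset.filter
      (fun S => ∀ x ∈ ground, ∀ y ∈ S, rel x y → x ∈ S),
    ∏ x ∈ S, w x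

/-- The generating chain `f lo ≺ f (lo+1) ≺ ⋯ ≺ f hi`. -/
def chainRel {α : Type*} (f : ℕ → α) (lo hi : ℕ) : α → α → Prop :=
  fun p q => ∃ i, lo ≤ i ∧ i + 1 ≤ hi ∧ p = f i ∧ q = f (i + 1)

/-- The single generating relation `u ≺ v`. -/
def covRel {α : Type*} (u v : α) : α → α → Prop := fun p q => p = u ∧ q = v

/-- The order of a poset `P`, transported along `f`. -/
def posetRel {P α : Type*} [PartialOrder P] (f : P → α) : α → α → Prop :=
  fun p q => ∃ x y : P, x ≤ y ∧ p = f x ∧ q = f y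

/-- The elements `f lo, …, f hi`. -/
def natGround {α : Type*} (f : ℕ → α) (lo hi : ℕ) : Finset α := (Finset.Icc lo hi).image f

/-- All the elements of the finite poset `P`, transported along `f`. -/
def posetGround {P α : Type*} [Fintype P] (f : P → α) : Finset α := Finset.univ.image f

/-- Embedding of the tail poset `A`. -/
def eA (A B D : Type*) : A → A ⊕ (B ⊕ (D ⊕ ℕ)) := Sum.inl

/-- Embedding of the tail poset `B`. -/
def eB (A B D : Type*) : B → A ⊕ (B ⊕ (D ⊕ ℕ)) := fun y => Sum.inr (Sum.inl y)

/-- Embedding of the tail poset `D`. -/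
def eD (A B D : Type*) : D → A ⊕ (B ⊕ (D ⊕ ℕ)) := fun y => Sum.inr (Sum.inr (Sum.inl y))

/-- The chain elements `c₁, …, c_L`. -/
def eC (A B D : Type*) : ℕ → A ⊕ (B ⊕ (D ⊕ ℕ)) :=
  fun j => Sum.inr (Sum.inr (Sum.inr j))

/-- The sum, over the lower sets of `P` satisfying `p`, of the products of weights. -/
def lowerSum {P K : Type*} [Fintype P] [PartialOrder P] [CommSemiring K]
    (p : Finset P → Prop) (w : P → K) : K :=
  ∑ S ∈ Finset.univ.filter (fun S : Finset P => IsLowerSet (S : Set P) ∧ p S), ∏ x ∈ S, w x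

lemma lowerSum_congr {P K : Type*} [Fintype P] [PartialOrder P] [CommSemiring K]
    {p q : Finset P → Prop} (w : P → K) (h : ∀ S, p S ↔ q S) :
    lowerSum p w = lowerSum q w := by
  rw [show p = q from funext fun S => propext (h S)]

lemma lowerSum_mem_add_notMem {P K : Type*} [Fintype P] [PartialOrder P] [CommSemiring K]
    (x : P) (w : P → K) :
    lowerSum (fun S => x ∉ S) w + lowerSum (fun S => x ∈ S) w = lowerSum (fun _ => True) w := by
  unfold lowerSum
  simp only [Finset.sum_filter]
  rw [← Finset.sum_add_distrib]
  refine Finset.sum_congr rfl fun S _ => ?_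
  by_cases h₁ : IsLowerSet (S : Set P) <;> by_cases h₂ : x ∈ S <;> simp [h₁, h₂]

lemma idealSum_posetGround {P α K : Type*} [Fintype P] [PartialOrder P] [CommSemiring K]
    (f : P → α) (hf : Function.Injective f) (w : α → K) :
    idealSum (posetGround f) (posetRel f) w = lowerSum (fun _ => True) (fun x => w (f x)) := by
  unfold idealSum lowerSum
  symm
  refine Finset.sum_bij (fun S _ => S.image f) ?_ ?_ ?_ ?_
  · intro S hS
    simp only [Finset.mem_filter, Finset.mem_univ, true_and, and_true] at hS
    simp only [Finset.mem_filter, Finset.mem_powerset]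
    refine ⟨Finset.image_subset_image (Finset.subset_univ S), ?_⟩
    rintro _ - _ hy ⟨u, v, huv, rfl, rfl⟩
    rw [hf.mem_finset_image] at hy ⊢
    exact hS huv hy
  · intro S _ T _ h
    exact Finset.image_injective hf h
  · intro S hS
    simp only [Finset.mem_filter, Finset.mem_powerset] at hS
    obtain ⟨hS, hrel⟩ := hS
    refine ⟨Finset.univ.filter (fun x => f x ∈ S), ?_, ?_⟩
    · simp only [Finset.mem_filter, Finset.mem_univ, true_and, and_true]
      intro u v hvu hu
      simp only [Finset.coe_filter, Finset.mem_univ, true_and, Set.mem_ofPred_eq] at hu ⊢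
      exact hrel _ (Finset.mem_image_of_mem f (Finset.mem_univ v)) _ hu ⟨v, u, hvu, rfl, rfl⟩
    · ext y
      simp only [Finset.mem_image, Finset.mem_filter, Finset.mem_univ, true_and]
      constructor
      · rintro ⟨x, hx, rfl⟩
        exact hx
      · intro hy
        obtain ⟨x, -, rfl⟩ := Finset.mem_image.1 (hS hy)
        exact ⟨x, hy, rfl⟩
  · intro S _
    rw [Finset.prod_image hf.injOn]

/-- A down-closed part of a chain is an initial segment. -/
lemma exists_initial_segment (p : ℕ → Prop) (lo hi : ℕ) (h : lo ≤ hi)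
    (hp : ∀ i, lo ≤ i → i + 1 ≤ hi → p (i + 1) → p i) :
    ∃ j, lo ≤ j ∧ j ≤ hi + 1 ∧ ∀ i, lo ≤ i → i ≤ hi → (p i ↔ i < j) := by
  have hex : ∃ j, lo ≤ j ∧ (p j → hi < j) := ⟨hi + 1, by omega, fun _ => by omega⟩
  obtain ⟨h1, h2⟩ := Nat.find_spec hex
  have hmin : Nat.find hex ≤ hi + 1 := Nat.find_min' hex ⟨by omega, fun _ => by omega⟩
  refine ⟨Nat.find hex, h1, hmin, fun i hlo hhi => ⟨fun hpi => ?_, fun hlt => ?_⟩⟩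
  · by_contra! hge
    have hdown : ∀ n, Nat.find hex ≤ n → n ≤ hi → ¬ p n := by
      intro n hn
      induction n, hn using Nat.le_induction with
      | base => exact fun hle hq => absurd (h2 hq) (by omega)
      | succ n hn ih => exact fun hle hq => ih (by omega) (hp n (by omega) hle hq)
    exact hdown i hge hhi hpi
  · have hnot := Nat.find_min hex hlt
    by_contra hpi
    exact hnot ⟨hlo, fun hq => absurd hq hpi⟩

/-- The ideal sum of a chain `c lo ≺ ⋯ ≺ c hi` with tails `A` (above `c lo` at `a`) and `B`
(below `c hi` at `b`), sorted by how far a down-set climbs along the chain. -/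
lemma idealSum_chain_eq_sum {A B α K : Type*} [Fintype A] [PartialOrder A] [Fintype B]
    [PartialOrder B] [CommSemiring K] (f : A → α) (g : B → α) (c : ℕ → α)
    (hf : Function.Injective f) (hg : Function.Injective g) (hc : Function.Injective c)
    (hfg : ∀ x y, f x ≠ g y) (hfc : ∀ x i, f x ≠ c i) (hgc : ∀ x i, g x ≠ c i)
    (a : A) (b : B) (lo hi : ℕ) (hlohi : lo ≤ hi) (w : α → K)
    (G : Finset α) (rel : α → α → Prop)
    (hG : ∀ x, x ∈ G ↔ x ∈ posetGround f ∨ x ∈ natGround c lo hi ∨ x ∈ posetGround g)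
    (hrel : ∀ x y, rel x y ↔ posetRel f x y ∨ posetRel g x y ∨ chainRel c lo hi x y ∨
      covRel (c lo) (f a) x y ∨ covRel (g b) (c hi) x y) :
    idealSum G rel w = ∑ j ∈ Finset.Icc lo (hi + 1),
      lowerSum (fun S => a ∈ S → lo < j) (fun x => w (f x)) *
        (∏ i ∈ Finset.Ico lo j, w (c i)) *
        lowerSum (fun S => j = hi + 1 → b ∈ S) (fun x => w (g x)) := by
  have hgf : ∀ x y, g y ≠ f x := fun x y => (hfg x y).symm
  have hcf : ∀ x i, c i ≠ f x := fun x i => (hfc x i).symm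
  have hcg : ∀ x i, c i ≠ g x := fun x i => (hgc x i).symm
  have hGf : ∀ x, f x ∈ G := fun x => (hG _).2 (Or.inl (by simp [posetGround]))
  have hGg : ∀ x, g x ∈ G := fun x => (hG _).2 (Or.inr (Or.inr (by simp [posetGround])))
  have hGc : ∀ i, lo ≤ i → i ≤ hi → c i ∈ G := fun i h1 h2 =>
    (hG _).2 (Or.inr (Or.inl (Finset.mem_image_of_mem _ (Finset.mem_Icc.2 ⟨h1, h2⟩))))
  let φ : ℕ × Finset A × Finset B → Finset α := fun t =>
    t.2.1.image f ∪ ((Finset.Ico lo t.1).image c ∪ t.2.2.image g)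
  have φf : ∀ t x, f x ∈ φ t ↔ x ∈ t.2.1 := fun t x => by
    simp [φ, hf.eq_iff, hgf, hcf]
  have φg : ∀ t x, g x ∈ φ t ↔ x ∈ t.2.2 := fun t x => by
    simp [φ, hg.eq_iff, hfg, hcg]
  have φc : ∀ t i, c i ∈ φ t ↔ lo ≤ i ∧ i < t.1 := fun t i => by
    simp [φ, hc.eq_iff, hfc, hgc]
  have key : idealSum G rel w = ∑ t ∈ Finset.Icc lo (hi + 1) ×ˢ
      ((Finset.univ : Finset (Finset A)) ×ˢ (Finset.univ : Finset (Finset B))) with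
      (IsLowerSet (t.2.1 : Set A) ∧ (a ∈ t.2.1 → lo < t.1)) ∧
        (IsLowerSet (t.2.2 : Set B) ∧ (t.1 = hi + 1 → b ∈ t.2.2)),
      (∏ x ∈ t.2.1, w (f x)) * (∏ i ∈ Finset.Ico lo t.1, w (c i)) * ∏ x ∈ t.2.2, w (g x) := by
    unfold idealSum
    symm
    refine Finset.sum_bij (fun t _ => φ t) ?_ ?_ ?_ ?_
    · intro t ht
      simp only [Finset.mem_filter, Finset.mem_product, Finset.mem_Icc, Finset.mem_univ,
        and_true] at ht
      obtain ⟨⟨h1, h2⟩, ⟨hA, ha⟩, hB, hb⟩ := ht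
      simp only [Finset.mem_filter, Finset.mem_powerset]
      constructor
      · intro x hx
        simp only [φ, Finset.mem_union, Finset.mem_image, Finset.mem_Ico] at hx
        rcases hx with ⟨y, -, rfl⟩ | ⟨y, hy, rfl⟩ | ⟨y, -, rfl⟩
        · exact hGf y
        · exact hGc y hy.1 (by omega)
        · exact hGg y
      · intro x _ y hy hxy
        rcases (hrel x y).1 hxy with ⟨u, v, huv, rfl, rfl⟩ | ⟨u, v, huv, rfl, rfl⟩ |
          ⟨i, hi1, hi2, rfl, rfl⟩ | ⟨rfl, rfl⟩ | ⟨rfl, rfl⟩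
        · rw [φf] at hy ⊢
          exact hA huv hy
        · rw [φg] at hy ⊢
          exact hB huv hy
        · rw [φc] at hy ⊢
          omega
        · rw [φf] at hy
          rw [φc]
          exact ⟨le_rfl, ha hy⟩
        · rw [φc] at hy
          rw [φg]
          exact hb (by omega)
    · intro t ht t' ht' h
      simp only [Finset.mem_filter, Finset.mem_product, Finset.mem_Icc] at ht ht'
      have e1 : t.2.1 = t'.2.1 := by
        ext x
        rw [← φf t, h, φf]
      have e2 : t.2.2 = t'.2.2 := by
        ext x
        rw [← φg t, h, φg]
      have e3 : ∀ i, (lo ≤ i ∧ i < t.1) ↔ (lo ≤ i ∧ i < t'.1) := fun i => by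
        rw [← φc t, h, φc]
      have e4 : t.1 = t'.1 := by
        have h1 := e3 t.1
        have h2 := e3 t'.1
        omega
      exact Prod.ext e4 (Prod.ext e1 e2)
    · intro S hS
      simp only [Finset.mem_filter, Finset.mem_powerset] at hS
      obtain ⟨hS, hdown⟩ := hS
      obtain ⟨j, hj1, hj2, hj⟩ := exists_initial_segment (fun i => c i ∈ S) lo hi hlohi
        (fun i h1 h2 hS' => hdown _ (hGc i h1 (by omega)) _ hS'
          ((hrel _ _).2 (Or.inr (Or.inr (Or.inl ⟨i, h1, h2, rfl, rfl⟩)))))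
      refine ⟨(j, Finset.univ.filter (fun x => f x ∈ S), Finset.univ.filter (fun x => g x ∈ S)),
        ?_, ?_⟩
      · simp only [Finset.mem_filter, Finset.mem_product, Finset.mem_Icc, Finset.mem_univ,
          and_true, true_and]
        refine ⟨⟨hj1, hj2⟩, ⟨?_, ?_⟩, ?_, ?_⟩
        · intro u v hvu hu
          simp only [Finset.coe_filter, Finset.mem_univ, true_and, Set.mem_ofPred_eq] at hu ⊢
          exact hdown _ (hGf v) _ hu ((hrel _ _).2 (Or.inl ⟨v, u, hvu, rfl, rfl⟩))
        · intro ha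
          exact (hj lo le_rfl hlohi).1 (hdown _ (hGc lo le_rfl hlohi) _ ha
            ((hrel _ _).2 (Or.inr (Or.inr (Or.inr (Or.inl ⟨rfl, rfl⟩))))))
        · intro u v hvu hu
          simp only [Finset.coe_filter, Finset.mem_univ, true_and, Set.mem_ofPred_eq] at hu ⊢
          exact hdown _ (hGg v) _ hu ((hrel _ _).2 (Or.inr (Or.inl ⟨v, u, hvu, rfl, rfl⟩)))
        · intro hjhi
          exact hdown _ (hGg b) _ ((hj hi hlohi le_rfl).2 (by omega))
            ((hrel _ _).2 (Or.inr (Or.inr (Or.inr (Or.inr ⟨rfl, rfl⟩)))))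
      · ext y
        by_cases hy : y ∈ G
        · rcases (hG y).1 hy with h | h | h
          · obtain ⟨x, -, rfl⟩ := Finset.mem_image.1 h
            rw [φf]
            simp
          · obtain ⟨i, hi', rfl⟩ := Finset.mem_image.1 h
            rw [Finset.mem_Icc] at hi'
            rw [φc, hj i hi'.1 hi'.2]
            simp [hi'.1]
          · obtain ⟨x, -, rfl⟩ := Finset.mem_image.1 h
            rw [φg]
            simp
        · refine iff_of_false (fun h => hy ?_) (fun h => hy (hS h))
          simp only [φ, Finset.mem_union, Finset.mem_image, Finset.mem_Ico] at h
          rcases h with ⟨y, -, rfl⟩ | ⟨i, hi', rfl⟩ | ⟨y, -, rfl⟩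
          · exact hGf y
          · exact hGc i hi'.1 (by omega)
          · exact hGg y
    · intro t _
      have d1 : Disjoint ((Finset.Ico lo t.1).image c) (t.2.2.image g) := by
        rw [Finset.disjoint_left]
        simp only [Finset.mem_image]
        rintro _ ⟨x, -, rfl⟩ ⟨y, -, hy⟩
        exact hgc _ _ hy
      have d2 : Disjoint (t.2.1.image f) ((Finset.Ico lo t.1).image c ∪ t.2.2.image g) := by
        rw [Finset.disjoint_left]
        simp only [Finset.mem_image, Finset.mem_union]
        rintro _ ⟨x, -, rfl⟩ (⟨y, -, hy⟩ | ⟨y, -, hy⟩)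
        · exact hcf _ _ hy
        · exact hgf _ _ hy
      simp only [φ]
      rw [Finset.prod_union d2, Finset.prod_union d1, Finset.prod_image hf.injOn,
        Finset.prod_image hg.injOn, Finset.prod_image hc.injOn, mul_assoc]
  rw [key, Finset.sum_filter, Finset.sum_product]
  refine Finset.sum_congr rfl fun j _ => ?_
  unfold lowerSum
  rw [Finset.sum_product, Finset.sum_filter, Finset.sum_filter, Finset.sum_mul, Finset.sum_mul]
  refine Finset.sum_congr rfl fun S _ => ?_
  rw [Finset.mul_sum]
  refine Finset.sum_congr rfl fun T _ => ?_
  by_cases h₁ : IsLowerSet (S : Set A) ∧ (a ∈ S → lo < j)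
  · by_cases h₂ : IsLowerSet (T : Set B) ∧ (j = hi + 1 → b ∈ T)
    · rw [if_pos ⟨h₁, h₂⟩, if_pos h₁, if_pos h₂]
    · rw [if_neg (fun h => h₂ h.2), if_neg h₂, mul_zero]
  · rw [if_neg (fun h => h₁ h.1), if_neg h₁, zero_mul, zero_mul]

lemma idealSum_chain {A B α K : Type*} [Fintype A] [PartialOrder A] [Fintype B]
    [PartialOrder B] [CommSemiring K] (f : A → α) (g : B → α) (c : ℕ → α)
    (hf : Function.Injective f) (hg : Function.Injective g) (hc : Function.Injective c)
    (hfg : ∀ x y, f x ≠ g y) (hfc : ∀ x i, f x ≠ c i) (hgc : ∀ x i, g x ≠ c i)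
    (a : A) (b : B) (lo hi : ℕ) (hlohi : lo ≤ hi) (w : α → K)
    (G : Finset α) (rel : α → α → Prop)
    (hG : ∀ x, x ∈ G ↔ x ∈ posetGround f ∨ x ∈ natGround c lo hi ∨ x ∈ posetGround g)
    (hrel : ∀ x y, rel x y ↔ posetRel f x y ∨ posetRel g x y ∨ chainRel c lo hi x y ∨
      covRel (c lo) (f a) x y ∨ covRel (g b) (c hi) x y) :
    idealSum G rel w =
      lowerSum (fun S => a ∉ S) (fun x => w (f x)) * lowerSum (fun _ => True) (fun x => w (g x)) +
      (∑ j ∈ Finset.Ico (lo + 1) (hi + 1), ∏ i ∈ Finset.Ico lo j, w (c i)) *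
        (lowerSum (fun _ => True) (fun x => w (f x)) *
          lowerSum (fun _ => True) (fun x => w (g x))) +
      (∏ i ∈ Finset.Ico lo (hi + 1), w (c i)) *
        (lowerSum (fun _ => True) (fun x => w (f x)) *
          lowerSum (fun S => b ∈ S) (fun x => w (g x))) := by
  rw [idealSum_chain_eq_sum f g c hf hg hc hfg hfc hgc a b lo hi hlohi w G rel hG hrel,
    ← Finset.Ico_add_one_right_eq_Icc, Finset.sum_Ico_succ_top (by omega),
    Finset.sum_eq_sum_Ico_succ_bot (by omega)]
  congr 1
  · congr 1
    · rw [lowerSum_congr (q := fun S => a ∉ S) _ (fun S => by simp),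
        lowerSum_congr (q := fun _ => True) (fun x => w (g x)) (fun S => by simp; omega)]
      simp
    · rw [Finset.sum_mul]
      refine Finset.sum_congr rfl fun j hj => ?_
      rw [Finset.mem_Ico] at hj
      rw [lowerSum_congr (q := fun _ => True) _ (fun S => by simp; omega),
        lowerSum_congr (q := fun _ => True) (fun x => w (g x)) (fun S => by simp; omega)]
      ring
  · rw [lowerSum_congr (q := fun _ => True) _ (fun S => by simp; omega),
      lowerSum_congr (q := fun S => b ∈ S) (fun x => w (g x)) (fun S => by simp)]
    ring

/-- The grafting identity, with the chain `c 1, …, c M` cut after `c N`. -/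
lemma chain_grafting_identity {K : Type*} [CommSemiring K] (y : ℕ → K) (N M : ℕ) (hN : 1 ≤ N)
    (hNM : N < M) (A₀ ZA ZB B₁ D₀ D₁ ZD : K) (hD : D₀ + D₁ = ZD) :
    (A₀ * ZB + (∑ j ∈ Finset.Ico (1 + 1) (M + 1), ∏ i ∈ Finset.Ico 1 j, y i) * (ZA * ZB) +
        (∏ i ∈ Finset.Ico 1 (M + 1), y i) * (ZA * B₁)) * ZD =
      (∏ i ∈ Finset.Icc 1 N, y i) *
        ((D₀ * ZB +
            (∑ j ∈ Finset.Ico (N + 1 + 1) (M + 1), ∏ i ∈ Finset.Ico (N + 1) j, y i) * (ZD * ZB) +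
            (∏ i ∈ Finset.Ico (N + 1) (M + 1), y i) * (ZD * B₁)) * ZA) +
      (A₀ * ZD + (∑ j ∈ Finset.Ico (1 + 1) (N + 1), ∏ i ∈ Finset.Ico 1 j, y i) * (ZA * ZD) +
        (∏ i ∈ Finset.Ico 1 (N + 1), y i) * (ZA * D₁)) * ZB := by
  have hprod : ∀ j, N + 1 ≤ j → ∏ i ∈ Finset.Ico 1 j, y i =
      (∏ i ∈ Finset.Ico 1 (N + 1), y i) * ∏ i ∈ Finset.Ico (N + 1) j, y i := fun j hj =>
    (Finset.prod_Ico_consecutive y (by omega) hj).symm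
  have hsum : ∑ j ∈ Finset.Ico (1 + 1) (M + 1), ∏ i ∈ Finset.Ico 1 j, y i =
      (∑ j ∈ Finset.Ico (1 + 1) (N + 1), ∏ i ∈ Finset.Ico 1 j, y i) +
        (∏ i ∈ Finset.Ico 1 (N + 1), y i) *
          (1 + ∑ j ∈ Finset.Ico (N + 1 + 1) (M + 1), ∏ i ∈ Finset.Ico (N + 1) j, y i) := by
    rw [← Finset.sum_Ico_consecutive _ (show 1 + 1 ≤ N + 1 by omega)
      (show N + 1 ≤ M + 1 by omega), Finset.sum_eq_sum_Ico_succ_bot (show N + 1 < M + 1 by omega),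
      mul_add, mul_one, Finset.mul_sum]
    congr 2
    refine Finset.sum_congr rfl fun j hj => hprod j ?_
    rw [Finset.mem_Ico] at hj
    omega
  rw [hsum, hprod (M + 1) (by omega), ← Finset.Ico_add_one_right_eq_Icc, ← hD]
  ring

theorem skein_type1_grafting_plain
    (K : Type*) [CommSemiring K]
    (m W r k ℓ : ℕ) (hm : 2 ≤ m) (hW : 2 ≤ W) (hr1 : 1 ≤ r) (hr2 : r ≤ W - 1)
    (hk1 : 1 ≤ k) (hk2 : k ≤ m) (hl1 : 1 ≤ ℓ) (hl2 : ℓ ≤ m)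
    (A B D : Type*)
    [Fintype A] [PartialOrder A] [Fintype B] [PartialOrder B]
    [Fintype D] [PartialOrder D]
    (a : A) (b : B) (d : D)
    (s : ℕ → K) (wA : A → K) (wB : B → K) (wD : D → K) :
    -- Z(P₁) · Z(D)
    idealSum
        (posetGround (eA A B D) ∪
          natGround (eC A B D) 1 ((W - 1) * m + (ℓ + m - k) % m + 1) ∪
          posetGround (eB A B D))
        (posetRel (eA A B D) ⊔ posetRel (eB A B D) ⊔
          chainRel (eC A B D) 1 ((W - 1) * m + (ℓ + m - k) % m + 1) ⊔
          covRel (eC A B D 1) (eA A B D a) ⊔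
          covRel (eB A B D b) (eC A B D ((W - 1) * m + (ℓ + m - k) % m + 1)))
        (Sum.elim wA (Sum.elim wB (Sum.elim wD
          (fun j => s ((k + j - 2) % m + 1))))) *
      idealSum (posetGround (eD A B D)) (posetRel (eD A B D))
        (Sum.elim wA (Sum.elim wB (Sum.elim wD
          (fun j => s ((k + j - 2) % m + 1)))))
    -- = Y′ · Z(P₃) · Z(A) + Z(P₅) · Z(B)
    = (∏ j ∈ Finset.Icc 1 ((r - 1) * m + (m - k + 1)), s ((k + j - 2) % m + 1)) *
        (idealSum
            (natGround (eC A B D) ((r - 1) * m + (m - k + 1) + 1)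
                ((W - 1) * m + (ℓ + m - k) % m + 1) ∪
              posetGround (eD A B D) ∪ posetGround (eB A B D))
            (chainRel (eC A B D) ((r - 1) * m + (m - k + 1) + 1)
                ((W - 1) * m + (ℓ + m - k) % m + 1) ⊔
              posetRel (eD A B D) ⊔ posetRel (eB A B D) ⊔
              covRel (eC A B D ((r - 1) * m + (m - k + 1) + 1)) (eD A B D d) ⊔
              covRel (eB A B D b) (eC A B D ((W - 1) * m + (ℓ + m - k) % m + 1)))
            (Sum.elim wA (Sum.elim wB (Sum.elim wD
              (fun j => s ((k + j - 2) % m + 1))))) *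
          idealSum (posetGround (eA A B D)) (posetRel (eA A B D))
            (Sum.elim wA (Sum.elim wB (Sum.elim wD
              (fun j => s ((k + j - 2) % m + 1))))))
      + idealSum
          (posetGround (eA A B D) ∪
            natGround (eC A B D) 1 ((r - 1) * m + (m - k + 1)) ∪
            posetGround (eD A B D))
          (posetRel (eA A B D) ⊔ posetRel (eD A B D) ⊔
            chainRel (eC A B D) 1 ((r - 1) * m + (m - k + 1)) ⊔
            covRel (eC A B D 1) (eA A B D a) ⊔
            covRel (eD A B D d) (eC A B D ((r - 1) * m + (m - k + 1))))
          (Sum.elim wA (Sum.elim wB (Sum.elim wD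
            (fun j => s ((k + j - 2) % m + 1))))) *
        idealSum (posetGround (eB A B D)) (posetRel (eB A B D))
          (Sum.elim wA (Sum.elim wB (Sum.elim wD
            (fun j => s ((k + j - 2) % m + 1))))) := by
  have hL : (r - 1) * m + (m - k + 1) < (W - 1) * m + (ℓ + m - k) % m + 1 := by
    obtain ⟨r, rfl⟩ : ∃ q, r = q + 1 := ⟨r - 1, by omega⟩
    have h : (r + 1) * m ≤ (W - 1) * m := Nat.mul_le_mul_right m hr2
    rw [add_mul, one_mul] at h
    rw [Nat.add_sub_cancel]
    omega
  generalize (W - 1) * m + (ℓ + m - k) % m + 1 = M at hL ⊢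
  have hN : 1 ≤ (r - 1) * m + (m - k + 1) := by omega
  generalize (r - 1) * m + (m - k + 1) = N at hL hN ⊢
  have iA : Function.Injective (eA A B D) := Sum.inl_injective
  have iB : Function.Injective (eB A B D) := Sum.inr_injective.comp Sum.inl_injective
  have iD : Function.Injective (eD A B D) :=
    Sum.inr_injective.comp (Sum.inr_injective.comp Sum.inl_injective)
  have iC : Function.Injective (eC A B D) :=
    Sum.inr_injective.comp (Sum.inr_injective.comp Sum.inr_injective)
  rw [idealSum_posetGround _ iA, idealSum_posetGround _ iB, idealSum_posetGround _ iD,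
    idealSum_chain (eA A B D) (eB A B D) (eC A B D) iA iB iC (by simp [eA, eB])
      (by simp [eA, eC]) (by simp [eB, eC]) a b 1 M (by omega) _ _ _
      (fun x => by simp only [Finset.mem_union]; tauto)
      (fun x y => by simp only [Pi.sup_apply, sup_Prop_eq]; tauto),
    idealSum_chain (eD A B D) (eB A B D) (eC A B D) iD iB iC (by simp [eD, eB])
      (by simp [eD, eC]) (by simp [eB, eC]) d b (N + 1) M (by omega) _ _ _
      (fun x => by simp only [Finset.mem_union]; tauto)
      (fun x y => by simp only [Pi.sup_apply, sup_Prop_eq]; tauto),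
    idealSum_chain (eA A B D) (eD A B D) (eC A B D) iA iD iC (by simp [eA, eD])
      (by simp [eA, eC]) (by simp [eD, eC]) a d 1 N (by omega) _ _ _
      (fun x => by simp only [Finset.mem_union]; tauto)
      (fun x y => by simp only [Pi.sup_apply, sup_Prop_eq]; tauto)]
  exact chain_grafting_identity (fun j => s ((k + j - 2) % m + 1)) N M hN hL _ _ _ _ _ _ _
    (lowerSum_mem_add_notMem d _)
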